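/- For every integer n ≥ 7 there exists a pseudo 3-regular finite simple graph on n vertices, and for every integer n ≥ 8 there exists a pseudo 4-regular finite simple graph on n vertices. -/

import Mathlib

open Finset

open scoped Classical in
/-- `G` is pseudo `k`-regular: it has no isolated vertices, it is `k`-harmonic
(`∑_{j ~ i} d_j = k·d_i` for all `i`, i.e. `m_i = k`), and it is not regular. -/
noncomputable def SimpleGraph.IsPseudoRegular {V : Type*} [Fintype V]
    (G : SimpleGraph V) (k : ℕ) : Prop :=
  (∀ i : V, 0 < G.degree i) ∧
  (∀ i : V, ∑ j ∈ G.neighborFinset i, G.degree j = k * G.degree i) ∧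
  ¬ ∃ d : ℕ, ∀ i : V, G.degree i = d

namespace SimpleGraph

section PseudoRegular

variable {V W : Type*} [Fintype V] [Fintype W]

/-- Pseudo-regularity may be checked with any decidability instance on adjacency. -/
theorem isPseudoRegular_iff (G : SimpleGraph V) [DecidableRel G.Adj] (k : ℕ) :
    G.IsPseudoRegular k ↔ (∀ i : V, 0 < G.degree i) ∧
      (∀ i : V, ∑ j ∈ G.neighborFinset i, G.degree j = k * G.degree i) ∧
      ¬ ∃ d : ℕ, ∀ i : V, G.degree i = d := by
  unfold IsPseudoRegular
  convert Iff.rfl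

/-- A decidable criterion for pseudo-regularity. -/
theorem isPseudoRegular_of_degree_ne {G : SimpleGraph V} [DecidableRel G.Adj] {k : ℕ}
    (hpos : ∀ i : V, 0 < G.degree i)
    (hsum : ∀ i : V, ∑ j ∈ G.neighborFinset i, G.degree j = k * G.degree i)
    (hne : ∃ i j : V, G.degree i ≠ G.degree j) : G.IsPseudoRegular k := by
  obtain ⟨i, j, hij⟩ := hne
  exact (isPseudoRegular_iff G k).2
    ⟨hpos, hsum, fun ⟨d, hd⟩ => hij ((hd i).trans (hd j).symm)⟩

theorem IsPseudoRegular.of_iso {G : SimpleGraph V} {H : SimpleGraph W} {k : ℕ}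
    (hG : G.IsPseudoRegular k) (e : G ≃g H) : H.IsPseudoRegular k := by
  classical
  obtain ⟨hpos, hsum, hreg⟩ := (isPseudoRegular_iff G k).1 hG
  have hdeg : ∀ v, H.degree (e v) = G.degree v := fun v => e.degree_eq v
  refine (isPseudoRegular_iff H k).2 ⟨e.surjective.forall.2 fun v => ?_,
    e.surjective.forall.2 fun v => ?_, fun ⟨d, hd⟩ => hreg ⟨d, fun v => ?_⟩⟩
  · rw [hdeg]
    exact hpos v
  · rw [hdeg, ← hsum v]
    symm
    refine Finset.sum_equiv e.toEquiv (fun w => ?_) fun w _ => (hdeg w).symm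
    simpa using (e.map_adj_iff (v := v) (w := w)).symm
  · rw [← hdeg]
    exact hd _

end PseudoRegular

section Sum

variable {V W : Type*} (G : SimpleGraph V) (H : SimpleGraph W)

theorem neighborFinset_sum_inl (v : V) [Fintype (G.neighborSet v)]
    [Fintype ((G ⊕g H).neighborSet (.inl v))] :
    (G ⊕g H).neighborFinset (.inl v) = (G.neighborFinset v).map .inl := by
  ext (w | w) <;> simp

theorem neighborFinset_sum_inr (w : W) [Fintype (H.neighborSet w)]
    [Fintype ((G ⊕g H).neighborSet (.inr w))] :
    (G ⊕g H).neighborFinset (.inr w) = (H.neighborFinset w).map .inr := by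
  ext (v | v) <;> simp

theorem degree_sum_inl (v : V) [Fintype (G.neighborSet v)]
    [Fintype ((G ⊕g H).neighborSet (.inl v))] :
    (G ⊕g H).degree (.inl v) = G.degree v := by
  rw [← card_neighborFinset_eq_degree, neighborFinset_sum_inl, card_map,
    card_neighborFinset_eq_degree]

theorem degree_sum_inr (w : W) [Fintype (H.neighborSet w)]
    [Fintype ((G ⊕g H).neighborSet (.inr w))] :
    (G ⊕g H).degree (.inr w) = H.degree w := by
  rw [← card_neighborFinset_eq_degree, neighborFinset_sum_inr, card_map,
    card_neighborFinset_eq_degree]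

end Sum

/-- The disjoint union of a pseudo `k`-regular graph with a `k`-regular graph, `k > 0`, is pseudo
`k`-regular. -/
theorem IsPseudoRegular.sum {V W : Type*} [Fintype V] [Fintype W] {G : SimpleGraph V}
    {H : SimpleGraph W} [DecidableRel H.Adj] {k : ℕ} (hG : G.IsPseudoRegular k)
    (hH : H.IsRegularOfDegree k) (hk : 0 < k) : (G ⊕g H).IsPseudoRegular k := by
  classical
  obtain ⟨hpos, hsum, hreg⟩ := (isPseudoRegular_iff G k).1 hG
  refine (isPseudoRegular_iff _ k).2 ⟨?_, ?_, fun ⟨d, hd⟩ => hreg ⟨d, fun v => ?_⟩⟩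
  · rintro (v | w)
    · rw [degree_sum_inl]
      exact hpos v
    · rw [degree_sum_inr, hH.degree_eq]
      exact hk
  · rintro (v | w)
    · rw [neighborFinset_sum_inl, sum_map, degree_sum_inl, ← hsum]
      exact sum_congr rfl fun u _ => by convert degree_sum_inl G H u; rfl
    · rw [neighborFinset_sum_inr, sum_map, degree_sum_inr, hH.degree_eq]
      refine (sum_const_nat fun u _ => ?_).trans (congrArg (· * k) (hH.degree_eq w))
      convert (degree_sum_inr G H u).trans (hH.degree_eq u); rfl
  · rw [← hd (.inl v), degree_sum_inl]

theorem IsPseudoRegular.exists_add {n k : ℕ} (hk : 0 < k)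
    (h : ∃ G : SimpleGraph (Fin n), G.IsPseudoRegular k) :
    ∃ G : SimpleGraph (Fin (n + (k + 1))), G.IsPseudoRegular k := by
  obtain ⟨G, hG⟩ := h
  have hK : (⊤ : SimpleGraph (Fin (k + 1))).IsRegularOfDegree k := by
    simpa using IsRegularOfDegree.top (V := Fin (k + 1))
  exact ⟨_, (hG.sum hK hk).of_iso (Iso.map finSumFinEquiv _)⟩

/-- If pseudo `k`-regular graphs exist for `k + 1` consecutive orders, they exist for all larger
orders. -/
theorem IsPseudoRegular.exists_of_le {k m : ℕ} (hk : 0 < k)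
    (hbase : ∀ n, m ≤ n → n ≤ m + k → ∃ G : SimpleGraph (Fin n), G.IsPseudoRegular k)
    (n : ℕ) (hn : m ≤ n) : ∃ G : SimpleGraph (Fin n), G.IsPseudoRegular k := by
  induction n using Nat.strong_induction_on with
  | _ n ih =>
    by_cases h : n ≤ m + k
    · exact hbase n hn h
    · obtain ⟨l, rfl⟩ : ∃ l, n = l + (k + 1) := ⟨n - (k + 1), by omega⟩
      exact exists_add hk (ih l (by omega) (by omega))

/-- The simple graph on `Fin n` with the given list of edges. -/
abbrev ofEdgeList (n : ℕ) (l : List (Fin n × Fin n)) : SimpleGraph (Fin n) :=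
  fromRel fun i j => (i, j) ∈ l

theorem exists_isPseudoRegular_three (n : ℕ) (h₁ : 7 ≤ n) (h₂ : n ≤ 10) :
    ∃ G : SimpleGraph (Fin n), G.IsPseudoRegular 3 := by
  interval_cases n
  · exact ⟨ofEdgeList 7
      [(0, 1), (1, 2), (1, 3), (2, 3), (0, 4), (1, 4), (0, 5), (3, 5), (2, 6), (4, 6)],
      isPseudoRegular_of_degree_ne (by decide +kernel) (by decide +kernel) (by decide +kernel)⟩
  · exact ⟨ofEdgeList 8
      [(0, 2), (1, 4), (2, 4), (2, 5), (3, 5), (2, 6), (4, 6), (5, 6), (0, 7), (6, 7)],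
      isPseudoRegular_of_degree_ne (by decide +kernel) (by decide +kernel) (by decide +kernel)⟩
  · exact ⟨ofEdgeList 9
      [(1, 2), (1, 3), (3, 4), (2, 5), (3, 5), (0, 6), (0, 7), (3, 7), (5, 7), (6, 7),
        (4, 8), (5, 8)],
      isPseudoRegular_of_degree_ne (by decide +kernel) (by decide +kernel) (by decide +kernel)⟩
  · exact ⟨ofEdgeList 10
      [(0, 3), (1, 3), (1, 4), (2, 4), (0, 5), (1, 5), (3, 6), (1, 7), (2, 7), (4, 7),
        (3, 8), (6, 8), (6, 9), (8, 9)],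
      isPseudoRegular_of_degree_ne (by decide +kernel) (by decide +kernel) (by decide +kernel)⟩

theorem exists_isPseudoRegular_four (n : ℕ) (h₁ : 8 ≤ n) (h₂ : n ≤ 12) :
    ∃ G : SimpleGraph (Fin n), G.IsPseudoRegular 4 := by
  interval_cases n
  · exact ⟨ofEdgeList 8
      [(0, 1), (2, 3), (0, 4), (1, 4), (0, 5), (1, 5), (2, 5), (3, 5), (2, 6), (3, 6),
        (1, 7), (2, 7), (3, 7), (4, 7), (5, 7)],
      isPseudoRegular_of_degree_ne (by decide +kernel) (by decide +kernel) (by decide +kernel)⟩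
  · exact ⟨ofEdgeList 9
      [(0, 1), (0, 3), (2, 3), (0, 4), (1, 4), (2, 4), (3, 5), (4, 5), (0, 6), (5, 6),
        (1, 7), (6, 7), (0, 8), (1, 8), (2, 8), (5, 8), (6, 8)],
      isPseudoRegular_of_degree_ne (by decide +kernel) (by decide +kernel) (by decide +kernel)⟩
  · exact ⟨ofEdgeList 10
      [(0, 2), (0, 3), (1, 3), (2, 3), (2, 4), (3, 5), (4, 5), (0, 6), (2, 7), (4, 7),
        (6, 7), (0, 8), (1, 8), (2, 8), (5, 8), (0, 9), (4, 9), (5, 9), (6, 9)],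
      isPseudoRegular_of_degree_ne (by decide +kernel) (by decide +kernel) (by decide +kernel)⟩
  · exact ⟨ofEdgeList 11
      [(0, 2), (1, 2), (1, 3), (2, 3), (0, 4), (2, 4), (2, 5), (0, 6), (0, 7), (6, 7),
        (4, 8), (5, 8), (0, 9), (3, 9), (4, 9), (5, 9), (7, 9), (1, 10), (3, 10), (4, 10)],
      isPseudoRegular_of_degree_ne (by decide +kernel) (by decide +kernel) (by decide +kernel)⟩
  · exact ⟨ofEdgeList 12
      [(1, 2), (0, 4), (2, 4), (3, 4), (0, 5), (3, 5), (2, 6), (3, 6), (1, 7), (4, 7),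
        (5, 7), (6, 7), (0, 8), (3, 8), (7, 8), (1, 9), (7, 9), (1, 10), (6, 10), (9, 10),
        (5, 11), (8, 11), (9, 11)],
      isPseudoRegular_of_degree_ne (by decide +kernel) (by decide +kernel) (by decide +kernel)⟩

end SimpleGraph

/-- For every `n ≥ 7` there is a pseudo `3`-regular graph on `n`
vertices, and for every `n ≥ 8` there is a pseudo `4`-regular graph on `n` vertices. -/
theorem exists_pseudo_three_and_four_regular :
    (∀ n : ℕ, 7 ≤ n → ∃ G : SimpleGraph (Fin n), G.IsPseudoRegular 3) ∧
    (∀ n : ℕ, 8 ≤ n → ∃ G : SimpleGraph (Fin n), G.IsPseudoRegular 4) := by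
  exact ⟨SimpleGraph.IsPseudoRegular.exists_of_le three_pos
      SimpleGraph.exists_isPseudoRegular_three,
    SimpleGraph.IsPseudoRegular.exists_of_le four_pos
      SimpleGraph.exists_isPseudoRegular_four⟩
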